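/- There is an absolute constant C such that for all real D ≥ 1, all positive integers N, and all complex numbers α_1, …, α_N: ∑_{d ≤ D, d odd} |∑_{h ≤ N} α_h ρ_h(d)| ≤ C D^{1/2} (D + N)^{1/2} (∑_{h ≤ N} |α_h|²)^{1/2}. -/

import Mathlib

/-- For a positive integer `d` and an integer `h`,
`ρ_h(d) = ∑_{v² + 3 ≡ 0 (mod d), 0 ≤ v < d} e(vh/d)`. -/
noncomputable def rhoExp (h : ℤ) (d : ℕ) : ℂ :=
  ∑ v ∈ (Finset.range d).filter (fun v => d ∣ v ^ 2 + 3),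
    Complex.exp (2 * Real.pi * Complex.I * ((v : ℂ) * h / d))

/-- Two roots `v₁ / d₁`, `v₂ / d₂` of `v² + 3 ≡ 0` with moduli of comparable size coincide as soon
as they are close: their joint invariant `d₁ m₂ + d₂ m₁ - 2 v₁ v₂` is an integer. -/
lemma root_eq_of_close {d₁ d₂ v₁ v₂ : ℤ} (h₁ : 0 < d₁) (h₂ : 0 < d₂)
    (h₁₂ : 2 * d₁ ≤ 3 * d₂) (h₂₁ : 2 * d₂ ≤ 3 * d₁)
    (hv₁ : d₁ ∣ v₁ ^ 2 + 3) (hv₂ : d₂ ∣ v₂ ^ 2 + 3)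
    (hclose : 2 * (d₁ * v₂ - d₂ * v₁) ^ 2 < d₁ * d₂) : d₁ = d₂ ∧ v₁ = v₂ := by
  obtain ⟨m₁, hm₁⟩ := hv₁
  obtain ⟨m₂, hm₂⟩ := hv₂
  have key : d₁ * d₂ * (d₁ * m₂ + d₂ * m₁ - 2 * v₁ * v₂ - 6)
      = (d₁ * v₂ - d₂ * v₁) ^ 2 + 3 * (d₁ - d₂) ^ 2 := by
    linear_combination (-d₂ ^ 2) * hm₁ - d₁ ^ 2 * hm₂
  have hpos : 0 < d₁ * d₂ := mul_pos h₁ h₂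
  have hd : 6 * (d₁ - d₂) ^ 2 ≤ d₁ * d₂ := by
    nlinarith [mul_nonneg (sub_nonneg.2 h₁₂) (sub_nonneg.2 h₂₁)]
  have hlt : d₁ * m₂ + d₂ * m₁ - 2 * v₁ * v₂ - 6 < 1 := by
    by_contra! h
    nlinarith
  have hsum : (d₁ * v₂ - d₂ * v₁) ^ 2 + 3 * (d₁ - d₂) ^ 2 ≤ 0 := by
    rw [← key]
    exact mul_nonpos_of_nonneg_of_nonpos hpos.le (by linarith)
  have hz : (d₁ - d₂) ^ 2 = 0 := by
    nlinarith [sq_nonneg (d₁ * v₂ - d₂ * v₁), sq_nonneg (d₁ - d₂)]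
  have hw : (d₁ * v₂ - d₂ * v₁) ^ 2 = 0 := by
    nlinarith [sq_nonneg (d₁ * v₂ - d₂ * v₁), sq_nonneg (d₁ - d₂)]
  have hdd : d₁ = d₂ := sub_eq_zero.1 (pow_eq_zero_iff two_ne_zero |>.1 hz)
  refine ⟨hdd, ?_⟩
  subst hdd
  have := sub_eq_zero.1 (pow_eq_zero_iff two_ne_zero |>.1 hw)
  exact (mul_left_cancel₀ h₁.ne' this).symm

/-- The fractions `v / d` with `d ∣ v² + 3` and `2 n / 3 < d ≤ n` lie in distinct intervals
`[b / Q, (b + 1) / Q)` when `2 n ≤ Q`. -/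
lemma root_eq_of_div_eq {n Q d₁ d₂ v₁ v₂ : ℕ} (hQ : 2 * n ≤ Q)
    (h₁ : 2 * n < 3 * d₁) (h₁' : d₁ ≤ n) (h₂ : 2 * n < 3 * d₂) (h₂' : d₂ ≤ n)
    (hv₁ : d₁ ∣ v₁ ^ 2 + 3) (hv₂ : d₂ ∣ v₂ ^ 2 + 3)
    (hb : Q * v₁ / d₁ = Q * v₂ / d₂) : d₁ = d₂ ∧ v₁ = v₂ := by
  have p₁ : 0 < d₁ := by omega
  have p₂ : 0 < d₂ := by omega
  have l₁ : d₁ * (Q * v₁ / d₁) ≤ Q * v₁ := Nat.mul_div_le _ _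
  have u₁ : Q * v₁ < d₁ * (Q * v₁ / d₁ + 1) := Nat.lt_mul_div_succ _ p₁
  have l₂ : d₂ * (Q * v₂ / d₂) ≤ Q * v₂ := Nat.mul_div_le _ _
  have u₂ : Q * v₂ < d₂ * (Q * v₂ / d₂ + 1) := Nat.lt_mul_div_succ _ p₂
  rw [hb] at l₁ u₁
  generalize Q * v₂ / d₂ = b at l₁ u₁ l₂ u₂
  zify at *
  suffices h : (d₁ : ℤ) = d₂ ∧ (v₁ : ℤ) = v₂ from h
  have habs : |(Q : ℤ) * (d₁ * v₂ - d₂ * v₁)| ≤ d₁ * d₂ := by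
    rw [abs_le]
    constructor <;> nlinarith
  have hsq : (Q : ℤ) ^ 2 * (d₁ * v₂ - d₂ * v₁) ^ 2 ≤ (d₁ * d₂) ^ 2 := by
    rw [← mul_pow]
    exact sq_le_sq' (abs_le.1 habs).1 (abs_le.1 habs).2
  have hQ2 : 4 * (d₁ * d₂ : ℤ) ≤ (Q : ℤ) ^ 2 := by
    have a₁ : 2 * (d₁ : ℤ) ≤ Q := by linarith
    have a₂ : 2 * (d₂ : ℤ) ≤ Q := by linarith
    nlinarith
  have hpos : (0 : ℤ) < d₁ * d₂ := mul_pos p₁ p₂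
  refine root_eq_of_close p₁ p₂ (by linarith) (by linarith) hv₁ hv₂ ?_
  have h4 : 4 * (d₁ * v₂ - d₂ * v₁ : ℤ) ^ 2 ≤ d₁ * d₂ := by
    refine le_of_mul_le_mul_left ?_ hpos
    nlinarith [mul_le_mul_of_nonneg_right hQ2 (sq_nonneg (d₁ * v₂ - d₂ * v₁ : ℤ))]
  linarith

/-- Parseval's identity for the discrete Fourier transform of length `Q`. -/
lemma sum_norm_sq_expSum {N Q : ℕ} (hNQ : N < Q) (a : ℕ → ℂ) :
    ∑ b ∈ Finset.range Q, ‖∑ h ∈ Finset.Icc 1 N,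
        a h * Complex.exp (2 * Real.pi * Complex.I * (h * ((b : ℂ) / Q)))‖ ^ 2
      = Q * ∑ h ∈ Finset.Icc 1 N, ‖a h‖ ^ 2 := by
  have hQ : Q ≠ 0 := by omega
  have hζ := Complex.isPrimitiveRoot_exp Q hQ
  set ζ := Complex.exp (2 * Real.pi * Complex.I / Q) with hζdef
  have hexp (h b : ℕ) :
      Complex.exp (2 * Real.pi * Complex.I * (h * ((b : ℂ) / Q))) = (ζ ^ h) ^ b := by
    rw [hζdef, ← Complex.exp_nat_mul, ← Complex.exp_nat_mul]
    congr 1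
    ring
  have hconj : (starRingEnd ℂ) ζ = ζ⁻¹ := by
    rw [Complex.inv_def, Complex.normSq_eq_norm_sq, hζ.norm'_eq_one hQ]
    simp
  have hζ0 : ζ ≠ 0 := Complex.exp_ne_zero _
  have horth (h k : ℕ) (hh : h < Q) (hk : k < Q) :
      ∑ b ∈ Finset.range Q, (ζ ^ h * (ζ ^ k)⁻¹) ^ b = if h = k then (Q : ℂ) else 0 := by
    split_ifs with e
    · subst e
      simp [hζ0]
    · have hne : ζ ^ h * (ζ ^ k)⁻¹ ≠ 1 := by
        intro h1
        refine e (hζ.pow_inj hh hk ?_)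
        rwa [← div_eq_mul_inv, div_eq_one_iff_eq (pow_ne_zero _ hζ0)] at h1
      rw [geom_sum_eq hne, mul_pow, inv_pow, ← pow_mul, ← pow_mul, mul_comm h, mul_comm k,
        pow_mul, pow_mul, hζ.pow_eq_one]
      simp
  have hC : ((∑ b ∈ Finset.range Q, ‖∑ h ∈ Finset.Icc 1 N, a h * (ζ ^ h) ^ b‖ ^ 2 : ℝ) : ℂ)
      = ((Q * ∑ h ∈ Finset.Icc 1 N, ‖a h‖ ^ 2 : ℝ) : ℂ) := by
    push_cast
    simp_rw [← Complex.mul_conj', map_sum, map_mul, map_pow, hconj, Finset.sum_mul_sum]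
    rw [Finset.sum_comm, Finset.mul_sum]
    refine Finset.sum_congr rfl fun h hh => ?_
    rw [Finset.sum_comm]
    have hterm : ∀ k ∈ Finset.Icc 1 N, ∑ b ∈ Finset.range Q,
        a h * (ζ ^ h) ^ b * ((starRingEnd ℂ) (a k) * (ζ⁻¹ ^ k) ^ b)
        = if h = k then Q * (a h * (starRingEnd ℂ) (a k)) else 0 := by
      intro k hk
      rw [Finset.mem_Icc] at hh hk
      have := horth h k (by omega) (by omega)
      calc _ = a h * (starRingEnd ℂ) (a k) *
            ∑ b ∈ Finset.range Q, (ζ ^ h * (ζ ^ k)⁻¹) ^ b := by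
            rw [Finset.mul_sum]
            refine Finset.sum_congr rfl fun b _ => ?_
            rw [mul_pow, inv_pow]
            ring
        _ = _ := by
            rw [this]
            split_ifs <;> ring
    rw [Finset.sum_congr rfl hterm, Finset.sum_ite_eq, if_pos hh]
  simp_rw [hexp]
  exact_mod_cast hC

/-- A mean value form of the large sieve: at most one point `x i` is attached to each `b / Q`. -/
lemma sum_norm_expSum_le {ι : Type*} (s : Finset ι) {N Q : ℕ} (hNQ : N < Q) (a : ℕ → ℂ)
    (x : ι → ℝ) (b : ι → ℕ) (hbQ : ∀ i ∈ s, b i < Q) (hinj : Set.InjOn b s)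
    (hx : ∀ i ∈ s, |Q * x i - b i| ≤ 1) :
    ∑ i ∈ s, ‖∑ h ∈ Finset.Icc 1 N,
        a h * Complex.exp (2 * Real.pi * Complex.I * (h * (x i : ℂ)))‖
      ≤ Real.exp (2 * Real.pi) * (Real.sqrt s.card * Real.sqrt Q *
          Real.sqrt (∑ h ∈ Finset.Icc 1 N, ‖a h‖ ^ 2)) := by
  have hQ : (0 : ℝ) < Q := by exact_mod_cast (by omega : 0 < Q)
  have hQC : (Q : ℂ) ≠ 0 := by exact_mod_cast hQ.ne'
  set B := Real.sqrt s.card * Real.sqrt Q * Real.sqrt (∑ h ∈ Finset.Icc 1 N, ‖a h‖ ^ 2) with hB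
  have hB0 : 0 ≤ B := by positivity
  let T : ℕ → ℕ → ℂ := fun k c => ∑ h ∈ Finset.Icc 1 N,
    (a h * ((h : ℂ) / Q) ^ k) * Complex.exp (2 * Real.pi * Complex.I * (h * ((c : ℂ) / Q)))
  let z : ι → ℂ := fun i => 2 * Real.pi * Complex.I * ((Q * x i - b i : ℝ) : ℂ)
  have hz : ∀ i ∈ s, ‖z i‖ ≤ 2 * Real.pi := by
    intro i hi
    have : ‖z i‖ = 2 * Real.pi * |Q * x i - b i| := by
      simp only [z, norm_mul, Complex.norm_I, Complex.norm_real, Real.norm_eq_abs,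
        abs_of_pos Real.pi_pos]
      simp
    rw [this]
    exact mul_le_of_le_one_right (by positivity) (hx i hi)
  have hT (k : ℕ) : ∑ i ∈ s, ‖T k (b i)‖ ≤ B := by
    have h1 : ∑ i ∈ s, ‖T k (b i)‖ ^ 2 ≤ Q * ∑ h ∈ Finset.Icc 1 N, ‖a h‖ ^ 2 := by
      calc ∑ i ∈ s, ‖T k (b i)‖ ^ 2 = ∑ c ∈ s.image b, ‖T k c‖ ^ 2 :=
            (Finset.sum_image (f := fun c => ‖T k c‖ ^ 2) hinj).symm
        _ ≤ ∑ c ∈ Finset.range Q, ‖T k c‖ ^ 2 := by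
            refine Finset.sum_le_sum_of_subset_of_nonneg ?_ fun _ _ _ => by positivity
            intro c hc
            obtain ⟨i, hi, rfl⟩ := Finset.mem_image.1 hc
            exact Finset.mem_range.2 (hbQ i hi)
        _ = Q * ∑ h ∈ Finset.Icc 1 N, ‖a h * ((h : ℂ) / Q) ^ k‖ ^ 2 :=
            sum_norm_sq_expSum hNQ _
        _ ≤ _ := by
            gcongr with h hh
            rw [norm_mul, norm_pow, norm_div, Complex.norm_natCast, Complex.norm_natCast]
            refine mul_le_of_le_one_right (norm_nonneg _) (pow_le_one₀ (by positivity) ?_)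
            rw [div_le_one hQ]
            rw [Finset.mem_Icc] at hh
            exact_mod_cast (by omega : h ≤ Q)
    rw [hB, mul_assoc, ← Real.sqrt_mul hQ.le, ← Real.sqrt_mul (Nat.cast_nonneg _)]
    refine Real.le_sqrt_of_sq_le (sq_sum_le_card_mul_sum_sq.trans ?_)
    gcongr
  have hsum : ∀ i, HasSum (fun k => z i ^ k / (k.factorial : ℂ) * T k (b i))
      (∑ h ∈ Finset.Icc 1 N,
        a h * Complex.exp (2 * Real.pi * Complex.I * (h * (x i : ℂ)))) := by
    intro i
    have hterm : ∀ h ∈ Finset.Icc 1 N, HasSum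
        (fun k : ℕ => z i ^ k / (k.factorial : ℂ) * ((a h * ((h : ℂ) / Q) ^ k) *
          Complex.exp (2 * Real.pi * Complex.I * (h * ((b i : ℂ) / Q)))))
        (a h * Complex.exp (2 * Real.pi * Complex.I * (h * (x i : ℂ)))) := by
      intro h _
      have e := NormedSpace.expSeries_div_hasSum_exp (z i * ((h : ℂ) / Q))
      rw [← Complex.exp_eq_exp_ℂ] at e
      have e' := e.mul_left
        (a h * Complex.exp (2 * Real.pi * Complex.I * (h * ((b i : ℂ) / Q))))
      have hval : a h * Complex.exp (2 * Real.pi * Complex.I * (h * ((b i : ℂ) / Q))) *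
          Complex.exp (z i * ((h : ℂ) / Q))
          = a h * Complex.exp (2 * Real.pi * Complex.I * (h * (x i : ℂ))) := by
        rw [mul_assoc, ← Complex.exp_add]
        congr 2
        simp only [z]
        push_cast
        field_simp
        ring
      rw [hval] at e'
      have hfun : (fun k : ℕ => a h * Complex.exp (2 * Real.pi * Complex.I *
          (h * ((b i : ℂ) / Q))) * ((z i * ((h : ℂ) / Q)) ^ k / (k.factorial : ℂ)))
          = fun k : ℕ => z i ^ k / (k.factorial : ℂ) * ((a h * ((h : ℂ) / Q) ^ k) *
            Complex.exp (2 * Real.pi * Complex.I * (h * ((b i : ℂ) / Q)))) := by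
        funext k
        rw [mul_pow]
        ring
      exact hfun ▸ e'
    have := hasSum_sum hterm
    simpa only [T, Finset.mul_sum] using this
  refine le_of_tendsto' (tendsto_finsetSum s fun i _ => (hsum i).tendsto_sum_nat.norm)
    fun K => ?_
  calc ∑ i ∈ s, ‖∑ k ∈ Finset.range K, z i ^ k / (k.factorial : ℂ) * T k (b i)‖
      ≤ ∑ i ∈ s, ∑ k ∈ Finset.range K, (2 * Real.pi) ^ k / k.factorial * ‖T k (b i)‖ := by
        refine Finset.sum_le_sum fun i hi => (norm_sum_le _ _).trans ?_
        refine Finset.sum_le_sum fun k _ => ?_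
        rw [norm_mul, norm_div, norm_pow, Complex.norm_natCast]
        gcongr
        exact hz i hi
    _ = ∑ k ∈ Finset.range K, (2 * Real.pi) ^ k / k.factorial * ∑ i ∈ s, ‖T k (b i)‖ := by
        rw [Finset.sum_comm]
        simp_rw [Finset.mul_sum]
    _ ≤ ∑ k ∈ Finset.range K, (2 * Real.pi) ^ k / k.factorial * B := by
        gcongr with k _
        exact hT k
    _ ≤ Real.exp (2 * Real.pi) * B := by
        rw [← Finset.sum_mul]
        gcongr
        exact Real.sum_le_exp_of_nonneg (by positivity) K

/-- The large sieve for `ρ_h(d)` with `d` restricted to `(2 n / 3, n]`. -/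
lemma sum_norm_rhoExp_block_le (n N : ℕ) (hn : 0 < n) (α : ℕ → ℂ) :
    ∑ d ∈ Finset.Ioc (2 * n / 3) n, ‖∑ h ∈ Finset.Icc 1 N, α h * rhoExp (h : ℤ) d‖
      ≤ 2 * Real.exp (2 * Real.pi) * (Real.sqrt n * Real.sqrt (n + N) *
          Real.sqrt (∑ h ∈ Finset.Icc 1 N, ‖α h‖ ^ 2)) := by
  let s : Finset (Σ _ : ℕ, ℕ) := (Finset.Ioc (2 * n / 3) n).sigma
    fun d => (Finset.range d).filter fun v => d ∣ v ^ 2 + 3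
  have hs (p : Σ _ : ℕ, ℕ) (hp : p ∈ s) :
      2 * n < 3 * p.1 ∧ p.1 ≤ n ∧ p.2 < p.1 ∧ p.1 ∣ p.2 ^ 2 + 3 := by
    simp only [s, Finset.mem_sigma, Finset.mem_Ioc, Finset.mem_filter, Finset.mem_range] at hp
    omega
  have hinj (Q : ℕ) (hQ : 2 * n ≤ Q) : Set.InjOn (fun p : Σ _ : ℕ, ℕ => Q * p.2 / p.1) s := by
    rintro ⟨d₁, v₁⟩ hp ⟨d₂, v₂⟩ hq hpq
    obtain ⟨a₁, a₂, -, a₃⟩ := hs _ hp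
    obtain ⟨b₁, b₂, -, b₃⟩ := hs _ hq
    obtain ⟨rfl, rfl⟩ := root_eq_of_div_eq hQ a₁ a₂ b₁ b₂ a₃ b₃ hpq
    rfl
  have hlt (Q : ℕ) (hQ : 2 * n ≤ Q) (p : Σ _ : ℕ, ℕ) (hp : p ∈ s) : Q * p.2 / p.1 < Q := by
    obtain ⟨-, -, h, -⟩ := hs p hp
    exact Nat.div_lt_of_lt_mul (by nlinarith)
  have hcard : s.card ≤ 2 * n := by
    have := Finset.card_le_card_of_injOn (t := Finset.range (2 * n)) _
      (fun p hp => Finset.mem_coe.2 (Finset.mem_range.2 (hlt (2 * n) le_rfl p hp)))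
      (hinj _ le_rfl)
    simpa using this
  have hmain := sum_norm_expSum_le s (N := N) (Q := 2 * n + N) (by omega) α
    (fun p => (p.2 : ℝ) / p.1) _ (hlt _ (by omega)) (hinj _ (by omega)) (by
      intro p hp
      obtain ⟨-, -, h, -⟩ := hs p hp
      have hp1 : 0 < p.1 := by omega
      rw [← mul_div_assoc, ← Nat.cast_mul, ← Nat.floor_div_eq_div (K := ℝ), abs_le]
      have h1 := Nat.floor_le (a := (((2 * n + N) * p.2 : ℕ) : ℝ) / p.1) (by positivity)
      have h2 := Nat.lt_floor_add_one ((((2 * n + N) * p.2 : ℕ) : ℝ) / p.1)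
      constructor <;> linarith)
  have hsplit : ∑ d ∈ Finset.Ioc (2 * n / 3) n,
        ‖∑ h ∈ Finset.Icc 1 N, α h * rhoExp (h : ℤ) d‖
      ≤ ∑ p ∈ s, ‖∑ h ∈ Finset.Icc 1 N, α h *
          Complex.exp (2 * Real.pi * Complex.I * (h * (((p.2 : ℝ) / p.1 : ℝ) : ℂ)))‖ := by
    rw [Finset.sum_sigma]
    refine Finset.sum_le_sum fun d _ => ?_
    have : ∑ h ∈ Finset.Icc 1 N, α h * rhoExp (h : ℤ) d
        = ∑ v ∈ (Finset.range d).filter (fun v => d ∣ v ^ 2 + 3), ∑ h ∈ Finset.Icc 1 N, α h *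
          Complex.exp (2 * Real.pi * Complex.I * (h * (((v : ℝ) / d : ℝ) : ℂ))) := by
      rw [Finset.sum_comm]
      refine Finset.sum_congr rfl fun h _ => ?_
      rw [rhoExp, Finset.mul_sum]
      refine Finset.sum_congr rfl fun v _ => ?_
      congr 2
      push_cast
      ring
    rw [this]
    exact norm_sum_le _ _
  refine hsplit.trans (hmain.trans ?_)
  have e1 : Real.sqrt s.card ≤ Real.sqrt 2 * Real.sqrt n := by
    rw [← Real.sqrt_mul zero_le_two]
    exact Real.sqrt_le_sqrt (by exact_mod_cast hcard)
  have e2 : Real.sqrt ((2 * n + N : ℕ) : ℝ) ≤ Real.sqrt 2 * Real.sqrt (n + N) := by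
    rw [← Real.sqrt_mul zero_le_two]
    refine Real.sqrt_le_sqrt ?_
    push_cast
    linarith [(Nat.cast_nonneg N : (0 : ℝ) ≤ N)]
  calc _ ≤ Real.exp (2 * Real.pi) * ((Real.sqrt 2 * Real.sqrt n) *
        (Real.sqrt 2 * Real.sqrt (n + N)) *
          Real.sqrt (∑ h ∈ Finset.Icc 1 N, ‖α h‖ ^ 2)) := by gcongr
    _ = (Real.sqrt 2 * Real.sqrt 2) * Real.exp (2 * Real.pi) * (Real.sqrt n *
        Real.sqrt (n + N) * Real.sqrt (∑ h ∈ Finset.Icc 1 N, ‖α h‖ ^ 2)) := by ring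
    _ = _ := by rw [Real.mul_self_sqrt zero_le_two]

/-- The large sieve for `ρ_h(d)` over all moduli `d ≤ n`. -/
lemma sum_norm_rhoExp_le (N : ℕ) (α : ℕ → ℂ) (n : ℕ) :
    ∑ d ∈ Finset.Icc 1 n, ‖∑ h ∈ Finset.Icc 1 N, α h * rhoExp (h : ℤ) d‖
      ≤ 12 * Real.exp (2 * Real.pi) * (Real.sqrt n * Real.sqrt (n + N) *
          Real.sqrt (∑ h ∈ Finset.Icc 1 N, ‖α h‖ ^ 2)) := by
  induction n using Nat.strong_induction_on with
  | _ n ih =>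
    rcases Nat.eq_zero_or_pos n with rfl | hn
    · simp
    have hm : 2 * n / 3 < n := by omega
    have hunion : Finset.Icc 1 n = Finset.Icc 1 (2 * n / 3) ∪ Finset.Ioc (2 * n / 3) n := by
      ext d
      simp only [Finset.mem_union, Finset.mem_Icc, Finset.mem_Ioc]
      omega
    have hdisj : Disjoint (Finset.Icc 1 (2 * n / 3)) (Finset.Ioc (2 * n / 3) n) := by
      rw [Finset.disjoint_left]
      intro d
      simp only [Finset.mem_Icc, Finset.mem_Ioc]
      omega
    rw [hunion, Finset.sum_union hdisj]
    have h1 := ih _ hm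
    have h2 := sum_norm_rhoExp_block_le n N hn α
    have hmn : ((2 * n / 3 : ℕ) : ℝ) ≤ 2 / 3 * n := by
      have := Nat.div_mul_le_self (2 * n) 3
      have : ((2 * n / 3 : ℕ) : ℝ) * 3 ≤ 2 * n := by exact_mod_cast this
      linarith
    have e1 : Real.sqrt ((2 * n / 3 : ℕ) : ℝ) ≤ 5 / 6 * Real.sqrt n := by
      refine Real.sqrt_le_iff.2 ⟨by positivity, ?_⟩
      rw [mul_pow, Real.sq_sqrt (Nat.cast_nonneg _)]
      have : (0 : ℝ) ≤ n := Nat.cast_nonneg _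
      linarith
    have e2 : Real.sqrt (((2 * n / 3 : ℕ) : ℝ) + N) ≤ Real.sqrt (n + N) := by
      refine Real.sqrt_le_sqrt ?_
      gcongr
    have h3 : 12 * Real.exp (2 * Real.pi) * (Real.sqrt ((2 * n / 3 : ℕ) : ℝ) *
          Real.sqrt (((2 * n / 3 : ℕ) : ℝ) + N) *
          Real.sqrt (∑ h ∈ Finset.Icc 1 N, ‖α h‖ ^ 2))
        ≤ 12 * Real.exp (2 * Real.pi) * ((5 / 6 * Real.sqrt n) * Real.sqrt (n + N) *
          Real.sqrt (∑ h ∈ Finset.Icc 1 N, ‖α h‖ ^ 2)) := by gcongr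
    linarith

/-- `∑_{d ≤ D, d odd} |∑_{h ≤ N} α_h ρ_h(d)| ≤ C D^{1/2} (D + N)^{1/2} (∑ |α_h|²)^{1/2}`. -/
theorem large_sieve_rho :
    ∃ C : ℝ, ∀ D : ℝ, 1 ≤ D → ∀ N : ℕ, 0 < N → ∀ α : ℕ → ℂ,
      ∑ d ∈ (Finset.Icc 1 (Nat.floor D)).filter (fun d => Odd d),
        ‖∑ h ∈ Finset.Icc 1 N, α h * rhoExp (h : ℤ) d‖
        ≤ C * Real.sqrt D * Real.sqrt (D + N) *
            Real.sqrt (∑ h ∈ Finset.Icc 1 N, ‖α h‖ ^ 2) := by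
  refine ⟨12 * Real.exp (2 * Real.pi), fun D hD N _ α => ?_⟩
  have hfl : (Nat.floor D : ℝ) ≤ D := Nat.floor_le (by linarith)
  calc _ ≤ ∑ d ∈ Finset.Icc 1 (Nat.floor D),
        ‖∑ h ∈ Finset.Icc 1 N, α h * rhoExp (h : ℤ) d‖ :=
        Finset.sum_le_sum_of_subset_of_nonneg (Finset.filter_subset _ _)
          fun _ _ _ => norm_nonneg _
    _ ≤ _ := sum_norm_rhoExp_le N α _
    _ ≤ 12 * Real.exp (2 * Real.pi) * (Real.sqrt D * Real.sqrt (D + N) *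
          Real.sqrt (∑ h ∈ Finset.Icc 1 N, ‖α h‖ ^ 2)) := by gcongr
    _ = _ := by ring
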